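/- arXiv:1212.3920 — 2 statements merged into one kernel-verified Lean document; each statement's English description precedes it below -/
import Mathlib

section
/- Let κ > 0, set σ = σ₀(κ), c = c(κ), and let ρ = σ/c (so that σ₀(κ) = ρ c(κ)). Then for every Ω ∈ 𝕊 the free energy of the equilibrium ρM_{κΩ} for the potential Φ(r) = r²/2 + r³/3 satisfies the identity ∫_𝕊 ρM_{κΩ}(ω) ln(ρM_{κΩ}(ω)) dω − (σ²/2 + σ³/3) = ρ ln ρ − ρ ln(∫_𝕊 e^{κ υ·Ω} dυ) − (κ − σ)/6 + (2/3)σκ. -/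
open MeasureTheory Metric Real

/-- The order parameter `c(κ)` of the von Mises distribution in dimension `n`. -/
noncomputable def orderParam (n : ℕ) (κ : ℝ) : ℝ :=
  (∫ θ in (0:ℝ)..π, Real.cos θ * Real.exp (κ * Real.cos θ) * Real.sin θ ^ (n - 2)) /
  (∫ θ in (0:ℝ)..π, Real.exp (κ * Real.cos θ) * Real.sin θ ^ (n - 2))

/-- The uniform probability measure on the unit sphere of `ℝⁿ`. -/
noncomputable def unifSphere (n : ℕ) : Measure (sphere (0 : EuclideanSpace ℝ (Fin n)) 1) :=
  ((volume : Measure (EuclideanSpace ℝ (Fin n))).toSphere Set.univ)⁻¹ •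
    (volume : Measure (EuclideanSpace ℝ (Fin n))).toSphere

/-- The von Mises density `M_{κΩ}` with respect to the uniform probability measure. -/
noncomputable def vonMises (n : ℕ) (κ : ℝ) (Ω ω : sphere (0 : EuclideanSpace ℝ (Fin n)) 1) : ℝ :=
  Real.exp (κ * @inner ℝ _ _ (ω : EuclideanSpace ℝ (Fin n)) (Ω : EuclideanSpace ℝ (Fin n))) /
  ∫ υ, Real.exp (κ * @inner ℝ _ _ (υ : EuclideanSpace ℝ (Fin n)) (Ω : EuclideanSpace ℝ (Fin n)))
    ∂ unifSphere n

/-- The inverse `σ₀` of `h(r) = r + r²`. -/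
noncomputable def σ₀ (κ : ℝ) : ℝ := (Real.sqrt (1 + 4 * κ) - 1) / 2


lemma gauss_int (V : Type*) [NormedAddCommGroup V] [InnerProductSpace ℝ V] [FiniteDimensional ℝ V]
    [MeasurableSpace V] [BorelSpace V] : Integrable (fun x : V => Real.exp (-‖x‖^2)) := by
  apply Integrable.of_integral_ne_zero
  have := GaussianFourier.integral_rexp_neg_mul_sq_norm (V := V) (b := 1) one_pos
  simp only [neg_mul, one_mul] at this
  rw [this]
  positivity

lemma gauss_ne (V : Type*) [NormedAddCommGroup V] [InnerProductSpace ℝ V] [FiniteDimensional ℝ V]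
    [MeasurableSpace V] [BorelSpace V] : ∫ x : V, Real.exp (-‖x‖^2) ≠ 0 := by
  have := GaussianFourier.integral_rexp_neg_mul_sq_norm (V := V) (b := 1) one_pos
  simp only [neg_mul, one_mul] at this
  rw [this]
  positivity

lemma abs_div_sqrt_le (t s : ℝ) : t / √(t^2+s^2) ∈ Set.Icc (-1:ℝ) 1 := by
  rw [Set.mem_Icc, ← abs_le, abs_div, abs_of_nonneg (Real.sqrt_nonneg _)]
  apply div_le_one_of_le₀ _ (Real.sqrt_nonneg _)
  apply Real.abs_le_sqrt
  nlinarith [sq_nonneg s]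

lemma bdd_F (F : ℝ → ℝ) (hF : Continuous F) : ∃ B, ∀ t ∈ Set.Icc (-1:ℝ) 1, ‖F t‖ ≤ B :=
  isCompact_Icc.exists_bound_of_continuousOn hF.continuousOn

lemma lemA {E : Type*} [NormedAddCommGroup E] [InnerProductSpace ℝ E] [FiniteDimensional ℝ E]
    [MeasurableSpace E] [BorelSpace E] [Nontrivial E] :
    ∃ K : ℝ, K ≠ 0 ∧ ∀ (F : ℝ → ℝ) (Ω : E),
      ∫ x : E, F (inner ℝ x Ω / ‖x‖) * Real.exp (-‖x‖^2) =
       (∫ ω : sphere (0:E) 1, F (inner ℝ (ω:E) Ω) ∂(volume : Measure E).toSphere) * K := by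
  set K : ℝ := ∫ r : Set.Ioi (0:ℝ), Real.exp (-(r:ℝ)^2) ∂.volumeIoiPow (Module.finrank ℝ E - 1) with hK
  have main : ∀ (F : ℝ → ℝ) (Ω : E),
      ∫ x : E, F (inner ℝ x Ω / ‖x‖) * Real.exp (-‖x‖^2) =
       (∫ ω : sphere (0:E) 1, F (inner ℝ (ω:E) Ω) ∂(volume : Measure E).toSphere) * K := by
    intro F Ω
    have h1 : ∫ x : E, F (inner ℝ x Ω / ‖x‖) * Real.exp (-‖x‖^2) =
      ∫ x : ({(0:E)}ᶜ : Set E), F (inner ℝ x.1 Ω / ‖x.1‖) * Real.exp (-‖x.1‖^2) ∂((volume : Measure E).comap Subtype.val) := by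
      rw [integral_subtype_comap (measurableSet_singleton _).compl
        fun x ↦ F (inner ℝ x Ω / ‖x‖) * Real.exp (-‖x‖^2),
        restrict_compl_singleton]
    rw [h1, hK, ← integral_prod_mul, ← (volume : Measure E).measurePreserving_homeomorphUnitSphereProd.integral_comp
        (Homeomorph.measurableEmbedding _)]
    congr 1
    ext x
    simp [inner_smul_left, div_eq_inv_mul]
  refine ⟨K, ?_, main⟩
  intro h
  have := main (fun _ => 1) 0
  rw [h] at this
  simp only [one_mul, mul_zero] at this
  exact gauss_ne E this

lemma lemC {E : Type*} [NormedAddCommGroup E] [InnerProductSpace ℝ E] [FiniteDimensional ℝ E]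
    [MeasurableSpace E] [BorelSpace E] (Ω : E) (hΩ : ‖Ω‖ = 1) (F : ℝ → ℝ) :
    ∫ x : E, F (inner ℝ x Ω / ‖x‖) * Real.exp (-‖x‖^2) =
    ∫ p : ℝ × (ℝ ∙ Ω)ᗮ, F (p.1 / √(p.1^2+‖p.2‖^2)) * Real.exp (-(p.1^2+‖p.2‖^2)) := by
  let e1 := LinearIsometryEquiv.toSpanUnitSingleton (𝕜 := ℝ) Ω hΩ
  let D := (ℝ ∙ Ω).orthogonalDecomposition
  have m1 : MeasurePreserving (Prod.map e1 (id : (ℝ ∙ Ω)ᗮ → (ℝ ∙ Ω)ᗮ)) :=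
    e1.measurePreserving.prod (MeasurePreserving.id _)
  have m2 := WithLp.volume_preserving_toLp (ℝ ∙ Ω) (ℝ ∙ Ω)ᗮ
  have m3 := D.symm.measurePreserving
  have m := (m3.comp m2).comp m1
  have hemb : MeasurableEmbedding ((D.symm ∘ WithLp.toLp 2) ∘ (Prod.map e1 (id : (ℝ ∙ Ω)ᗮ → (ℝ ∙ Ω)ᗮ))) := by
    have hc : Continuous ((D.symm ∘ WithLp.toLp 2) ∘ (Prod.map e1 (id : (ℝ ∙ Ω)ᗮ → (ℝ ∙ Ω)ᗮ))) := by
      refine (D.symm.continuous.comp (WithLp.prod_continuous_toLp ..)).comp (e1.continuous.prodMap continuous_id)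
    apply hc.measurableEmbedding
    exact (D.symm.injective.comp (WithLp.toLp_injective 2)).comp (e1.injective.prodMap Function.injective_id)
  rw [← m.integral_comp hemb]
  congr 1
  ext ⟨t, y⟩
  have hD : ((D.symm ∘ WithLp.toLp 2) ∘ (Prod.map e1 (id : (ℝ ∙ Ω)ᗮ → (ℝ ∙ Ω)ᗮ))) (t, y) = t • Ω + (y:E) := by
    simp [D, e1]
  have hy : inner ℝ (y:E) Ω = 0 := by
    rw [real_inner_comm]; exact Submodule.mem_orthogonal_singleton_iff_inner_right.1 y.2
  have hin : inner ℝ (t • Ω + (y:E)) Ω = t := by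
    simp [inner_add_left, inner_smul_left, hy, hΩ]
  have hn : ‖t • Ω + (y:E)‖^2 = t^2 + ‖y‖^2 := by
    rw [@norm_add_sq_real, inner_smul_left, real_inner_comm, hy, norm_smul, hΩ]; simp
  rw [hD, hin, hn, ← hn, Real.sqrt_sq (norm_nonneg _)]

lemma lemB {V : Type*} [NormedAddCommGroup V] [InnerProductSpace ℝ V] [FiniteDimensional ℝ V]
    [MeasurableSpace V] [BorelSpace V] [Nontrivial V] :
    ∃ C : ℝ, ∀ F : ℝ → ℝ, Continuous F →
      ∫ p : ℝ × V, F (p.1 / √(p.1^2+‖p.2‖^2)) * Real.exp (-(p.1^2+‖p.2‖^2)) =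
      C * ∫ θ in (0:ℝ)..π, F (Real.cos θ) * Real.sin θ ^ (Module.finrank ℝ V - 1) := by
  set k := Module.finrank ℝ V - 1 with hk
  set G : ℝ := ∫ r in Set.Ioi (0:ℝ), r ^ (k+1) * Real.exp (-r^2) with hG
  refine ⟨Module.finrank ℝ V * (volume : Measure V).real (ball 0 1) * G, fun F hF => ?_⟩
  obtain ⟨B, hB⟩ := bdd_F F hF
  have hg1 : Integrable (fun t : ℝ => Real.exp (-t^2)) := by
    simpa using gauss_int ℝ
  have hgV := gauss_int V
  have hgV' := (integrable_fun_norm_addHaar (volume : Measure V) (f := fun r => Real.exp (-r^2))).1 hgV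
  rw [← hk] at hgV'
  have i1 : Integrable (fun p : ℝ × V => F (p.1 / √(p.1^2+‖p.2‖^2)) * Real.exp (-(p.1^2+‖p.2‖^2))) := by
    refine ((hg1.mul_prod hgV).const_mul B).mono' ?_ ?_
    · apply Measurable.aestronglyMeasurable
      have := hF.measurable
      fun_prop
    · refine Filter.Eventually.of_forall fun p => ?_
      rw [norm_mul, Real.norm_of_nonneg (Real.exp_nonneg _), neg_add, Real.exp_add]
      gcongr
      exact hB _ (abs_div_sqrt_le _ _)
  let H : ℝ → ℝ → ℝ := fun t s => s ^ k * (F (t / √(t^2+s^2)) * Real.exp (-(t^2+s^2)))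
  have i2 : Integrable (fun p : ℝ × ℝ => H p.1 p.2)
      ((volume : Measure ℝ).prod (volume.restrict (Set.Ioi (0:ℝ)))) := by
    refine ((hg1.mul_prod hgV').const_mul B).mono' ?_ ?_
    · apply Measurable.aestronglyMeasurable
      have := hF.measurable
      fun_prop
    · have : ∀ᵐ p : ℝ × ℝ ∂((volume : Measure ℝ).prod (volume.restrict (Set.Ioi (0:ℝ)))), 0 < p.2 := by
        have h0 : ∀ᵐ s : ℝ ∂(volume.restrict (Set.Ioi (0:ℝ))), 0 < s :=
          ae_restrict_mem measurableSet_Ioi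
        exact Measure.quasiMeasurePreserving_snd.ae h0
      filter_upwards [this] with p hp
      simp only [H]
      rw [norm_mul, norm_mul, Real.norm_of_nonneg (Real.exp_nonneg _), neg_add, Real.exp_add,
        Real.norm_of_nonneg (pow_nonneg hp.le _)]
      have := hB _ (abs_div_sqrt_le p.1 p.2)
      calc _ ≤ p.2 ^ k * (B * (rexp (-p.1 ^ 2) * rexp (-p.2 ^ 2))) := by gcongr
        _ = _ := by simp only [smul_eq_mul]; ring
  rw [Measure.volume_eq_prod, integral_prod _ i1]
  have s1 : ∀ t : ℝ, ∫ y : V, F (t / √(t^2+‖y‖^2)) * Real.exp (-(t^2+‖y‖^2)) =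
      Module.finrank ℝ V * (volume : Measure V).real (ball 0 1) * ∫ s in Set.Ioi (0:ℝ), H t s := by
    intro t
    rw [integral_fun_norm_addHaar (volume : Measure V)
      (fun r => F (t / √(t^2+r^2)) * Real.exp (-(t^2+r^2)))]
    simp only [nsmul_eq_mul, smul_eq_mul, H, hk, mul_assoc]
  simp_rw [s1]
  rw [integral_const_mul, ← integral_prod _ i2, mul_assoc, mul_assoc, mul_assoc]
  congr 2
  have s2 : (volume : Measure ℝ).prod (volume.restrict (Set.Ioi (0:ℝ))) =
      (volume : Measure (ℝ × ℝ)).restrict (Set.univ ×ˢ Set.Ioi (0:ℝ)) := by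
    rw [Measure.volume_eq_prod, ← Measure.prod_restrict, Measure.restrict_univ]
  have ms : MeasurableSet (Set.univ ×ˢ Set.Ioi (0:ℝ) : Set (ℝ × ℝ)) :=
    MeasurableSet.univ.prod measurableSet_Ioi
  rw [s2, ← integral_indicator ms, ← integral_comp_polarCoord_symm]
  have s3 : ∀ p ∈ polarCoord.target, p.1 • (Set.univ ×ˢ Set.Ioi (0:ℝ)).indicator
      (fun p : ℝ × ℝ => H p.1 p.2) (polarCoord.symm p) =
      (p.1 ^ (k+1) * Real.exp (-p.1^2)) *
       (Set.Ioo 0 π).indicator (fun θ => F (Real.cos θ) * Real.sin θ ^ k) p.2 := by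
    rintro ⟨r, θ⟩ ⟨hr, hθ⟩
    simp only [Set.mem_Ioi] at hr
    simp only [Set.mem_Ioo] at hθ
    rw [polarCoord_symm_apply]
    by_cases h : 0 < θ
    · have hs : 0 < Real.sin θ := Real.sin_pos_of_pos_of_lt_pi h hθ.2
      rw [Set.indicator_of_mem (by simp [hr, hs]), Set.indicator_of_mem (by simp [h, hθ.2])]
      have e : (r * Real.cos θ)^2 + (r * Real.sin θ)^2 = r^2 := by
        linear_combination r^2 * Real.sin_sq_add_cos_sq θ
      simp only [H, e, Real.sqrt_sq hr.le, smul_eq_mul]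
      rw [mul_div_cancel_left₀ _ hr.ne']
      ring
    · have hs : Real.sin θ ≤ 0 := Real.sin_nonpos_of_nonpos_of_neg_pi_le (not_lt.1 h) hθ.1.le
      rw [Set.indicator_of_notMem, Set.indicator_of_notMem (by simp [h])]
      · simp
      · simp; exact mul_nonpos_of_nonneg_of_nonpos hr.le hs
  rw [setIntegral_congr_fun polarCoord.open_target.measurableSet s3]
  have ht : polarCoord.target = Set.Ioi (0:ℝ) ×ˢ Set.Ioo (-π) π := rfl
  rw [ht, Measure.volume_eq_prod, setIntegral_prod_mul (fun r : ℝ => r ^ (k+1) * Real.exp (-r^2))]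
  congr 1
  rw [setIntegral_indicator measurableSet_Ioo, intervalIntegral.integral_of_le Real.pi_pos.le,
    integral_Ioc_eq_integral_Ioo]
  congr 2
  ext θ
  simp only [Set.mem_inter_iff, Set.mem_Ioo]
  constructor
  · exact fun h => h.2
  · exact fun h => ⟨⟨by linarith [Real.pi_pos, h.1], h.2⟩, h⟩

lemma unif_prob (n : ℕ) (hn : 2 ≤ n) : IsProbabilityMeasure (unifSphere n) := by
  have : Nonempty (Fin n) := ⟨⟨0, by omega⟩⟩
  constructor
  rw [unifSphere, Measure.smul_apply, smul_eq_mul]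
  apply ENNReal.inv_mul_cancel
  · rw [Ne, Measure.measure_univ_eq_zero]
    exact Measure.toSphere_ne_zero _
  · exact measure_ne_top _ _

lemma zonal (n : ℕ) (hn : 2 ≤ n) (Ω : sphere (0 : EuclideanSpace ℝ (Fin n)) 1) :
    ∃ C : ℝ, C ≠ 0 ∧ ∀ F : ℝ → ℝ, Continuous F →
      ∫ ω, F (inner ℝ (ω : EuclideanSpace ℝ (Fin n)) (Ω : EuclideanSpace ℝ (Fin n))) ∂unifSphere n =
      C * ∫ θ in (0:ℝ)..π, F (Real.cos θ) * Real.sin θ ^ (n - 2) := by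
  have : Nonempty (Fin n) := ⟨⟨0, by omega⟩⟩
  have hΩ : ‖(Ω : EuclideanSpace ℝ (Fin n))‖ = 1 := by simp
  obtain ⟨K, hK, hA⟩ := lemA (E := EuclideanSpace ℝ (Fin n))
  have hd := Submodule.finrank_add_finrank_orthogonal (ℝ ∙ (Ω : EuclideanSpace ℝ (Fin n)))
  rw [finrank_span_singleton (by intro h; simp [h] at hΩ), finrank_euclideanSpace_fin] at hd
  have : Nontrivial (ℝ ∙ (Ω : EuclideanSpace ℝ (Fin n)))ᗮ :=
    Module.nontrivial_of_finrank_pos (R := ℝ) (by omega)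
  obtain ⟨C, hC⟩ := lemB (V := (ℝ ∙ (Ω : EuclideanSpace ℝ (Fin n)))ᗮ)
  have hd' : Module.finrank ℝ (ℝ ∙ (Ω : EuclideanSpace ℝ (Fin n)))ᗮ - 1 = n - 2 := by omega
  rw [hd'] at hC
  have main : ∀ F : ℝ → ℝ, Continuous F →
      ∫ ω, F (inner ℝ (ω : EuclideanSpace ℝ (Fin n)) (Ω : EuclideanSpace ℝ (Fin n))) ∂unifSphere n =
      ((((volume : Measure (EuclideanSpace ℝ (Fin n))).toSphere Set.univ)⁻¹).toReal * (C / K)) *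
        ∫ θ in (0:ℝ)..π, F (Real.cos θ) * Real.sin θ ^ (n - 2) := by
    intro F hF
    have h := hA F Ω
    rw [lemC _ hΩ, hC F hF] at h
    rw [unifSphere, integral_smul_measure, smul_eq_mul, mul_assoc, div_mul_eq_mul_div, h,
      mul_div_cancel_right₀ _ hK]
  refine ⟨_, ?_, main⟩
  intro h
  have h1 := main (fun _ => 1) continuous_const
  have := unif_prob n hn
  rw [h] at h1
  simp at h1

lemma num_pos (k : ℕ) (κ : ℝ) (hκ : 0 < κ) :
    0 < ∫ θ in (0:ℝ)..π, Real.cos θ * Real.exp (κ * Real.cos θ) * Real.sin θ ^ k := by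
  have h0 : ∫ θ in (0:ℝ)..π, Real.cos θ * Real.sin θ ^ k = 0 := by
    have := intervalIntegral.integral_comp_sub_left (a := 0) (b := π)
      (fun θ => Real.cos θ * Real.sin θ ^ k) π
    simp only [Real.cos_pi_sub, Real.sin_pi_sub, neg_mul, intervalIntegral.integral_neg, sub_self,
      sub_zero] at this
    linarith
  have h1 : 0 < ∫ θ in (0:ℝ)..π, (Real.cos θ * Real.exp (κ * Real.cos θ) * Real.sin θ ^ k -
      Real.cos θ * Real.sin θ ^ k) := by
    apply intervalIntegral.integral_pos Real.pi_pos
    · fun_prop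
    · intro θ hθ
      have hs : 0 ≤ Real.sin θ ^ k := pow_nonneg (Real.sin_nonneg_of_nonneg_of_le_pi hθ.1.le hθ.2) _
      have : 0 ≤ Real.cos θ * (Real.exp (κ * Real.cos θ) - 1) := by
        rcases le_total 0 (Real.cos θ) with h | h
        · exact mul_nonneg h (sub_nonneg.2 (Real.one_le_exp (by positivity)))
        · exact mul_nonneg_of_nonpos_of_nonpos h
            (sub_nonpos.2 (Real.exp_le_one_iff.2 (mul_nonpos_of_nonneg_of_nonpos hκ.le h)))
      nlinarith [mul_nonneg this hs]
    · refine ⟨π / 4, ⟨by positivity, by linarith [Real.pi_pos]⟩, ?_⟩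
      have hs : 0 < Real.sin (π / 4) ^ k := by rw [Real.sin_pi_div_four]; positivity
      have hc : 0 < Real.cos (π / 4) := by rw [Real.cos_pi_div_four]; positivity
      have : 0 < Real.cos (π / 4) * (Real.exp (κ * Real.cos (π / 4)) - 1) :=
        mul_pos hc (sub_pos.2 (Real.one_lt_exp_iff.2 (by positivity)))
      nlinarith [mul_pos this hs]
  rw [intervalIntegral.integral_sub (Continuous.intervalIntegrable (by fun_prop) _ _)
    (Continuous.intervalIntegrable (by fun_prop) _ _), h0, sub_zero] at h1
  exact h1

/-- Free energy identity for the equilibrium `ρ M_{κΩ}` with `ρ = σ₀(κ)/c(κ)` and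
potential `Φ(r) = r²/2 + r³/3`. -/
theorem free_energy_identity (n : ℕ) (hn : 2 ≤ n) (κ : ℝ) (hκ : 0 < κ)
    (Ω : sphere (0 : EuclideanSpace ℝ (Fin n)) 1)
    (σ c ρ : ℝ) (hσ : σ = σ₀ κ) (hc : c = orderParam n κ) (hρ : ρ = σ / c) :
    (∫ ω, (ρ * vonMises n κ Ω ω) * Real.log (ρ * vonMises n κ Ω ω) ∂ unifSphere n)
        - (σ ^ 2 / 2 + σ ^ 3 / 3)
      = ρ * Real.log ρ
        - ρ * Real.log (∫ υ, Real.exp (κ *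
            @inner ℝ _ _ (υ : EuclideanSpace ℝ (Fin n)) (Ω : EuclideanSpace ℝ (Fin n)))
              ∂ unifSphere n)
        - (κ - σ) / 6 + (2 / 3) * σ * κ := by
  have hprob := unif_prob n hn
  obtain ⟨C, hC0, hC⟩ := zonal n hn Ω
  have hZ := hC (fun t => Real.exp (κ * t)) (by fun_prop)
  have hN := hC (fun t => t * Real.exp (κ * t)) (by fun_prop)
  have hcont : Continuous fun ω : sphere (0 : EuclideanSpace ℝ (Fin n)) 1 =>
      inner ℝ (ω : EuclideanSpace ℝ (Fin n)) (Ω : EuclideanSpace ℝ (Fin n)) := by fun_prop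
  have hint : ∀ f : sphere (0 : EuclideanSpace ℝ (Fin n)) 1 → ℝ, Continuous f →
      Integrable f (unifSphere n) := fun f hf =>
    hf.integrable_of_hasCompactSupport (HasCompactSupport.of_compactSpace f)
  have hZpos : 0 < ∫ υ, Real.exp (κ *
            @inner ℝ _ _ (υ : EuclideanSpace ℝ (Fin n)) (Ω : EuclideanSpace ℝ (Fin n)))
              ∂ unifSphere n :=
    integral_exp_pos (hint _ (by fun_prop))
  have hnum := num_pos (n - 2) κ hκ
  simp only [vonMises]
  set Z := ∫ υ, Real.exp (κ *
            @inner ℝ _ _ (υ : EuclideanSpace ℝ (Fin n)) (Ω : EuclideanSpace ℝ (Fin n)))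
              ∂ unifSphere n with hZdef
  have hden : (∫ θ in (0:ℝ)..π, Real.exp (κ * Real.cos θ) * Real.sin θ ^ (n - 2)) ≠ 0 := by
    intro h; rw [h, mul_zero] at hZ; exact hZpos.ne' hZ
  have hc0 : c ≠ 0 := by
    rw [hc, orderParam]; exact div_ne_zero hnum.ne' hden
  have hNc : ∫ ω, inner ℝ (ω : EuclideanSpace ℝ (Fin n)) (Ω : EuclideanSpace ℝ (Fin n)) *
      Real.exp (κ * inner ℝ (ω : EuclideanSpace ℝ (Fin n)) (Ω : EuclideanSpace ℝ (Fin n)))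
      ∂unifSphere n = c * Z := by
    rw [hN, hZ, hc, orderParam]
    rw [mul_left_comm, div_mul_cancel₀ _ hden]
  have hsq : Real.sqrt (1 + 4 * κ) ^ 2 = 1 + 4 * κ := Real.sq_sqrt (by linarith)
  have hσκ : κ = σ + σ ^ 2 := by
    rw [hσ, σ₀]; linear_combination (-1/4) * hsq
  have hσ0 : σ ≠ 0 := by
    rintro rfl; norm_num at hσκ; exact hκ.ne' hσκ
  have hρ0 : ρ ≠ 0 := by rw [hρ]; exact div_ne_zero hσ0 hc0
  have hρc : ρ * c = σ := by rw [hρ]; field_simp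
  have hpt : ∀ ω : sphere (0 : EuclideanSpace ℝ (Fin n)) 1,
      (ρ * (Real.exp (κ * inner ℝ (ω : EuclideanSpace ℝ (Fin n)) (Ω : EuclideanSpace ℝ (Fin n))) / Z)) *
      Real.log (ρ * (Real.exp (κ * inner ℝ (ω : EuclideanSpace ℝ (Fin n)) (Ω : EuclideanSpace ℝ (Fin n))) / Z))
      = (ρ * (Real.log ρ - Real.log Z) / Z) *
          Real.exp (κ * inner ℝ (ω : EuclideanSpace ℝ (Fin n)) (Ω : EuclideanSpace ℝ (Fin n))) +
        (ρ * κ / Z) * (inner ℝ (ω : EuclideanSpace ℝ (Fin n)) (Ω : EuclideanSpace ℝ (Fin n)) *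
          Real.exp (κ * inner ℝ (ω : EuclideanSpace ℝ (Fin n)) (Ω : EuclideanSpace ℝ (Fin n)))) := by
    intro ω
    rw [Real.log_mul hρ0 (div_ne_zero (Real.exp_ne_zero _) hZpos.ne'),
      Real.log_div (Real.exp_ne_zero _) hZpos.ne', Real.log_exp]
    ring
  simp_rw [hpt]
  rw [integral_add ((hint _ (by fun_prop)).const_mul _) ((hint _ (by fun_prop)).const_mul _),
    integral_const_mul, integral_const_mul, hNc, ← hZdef]
  have e1 : ρ * (Real.log ρ - Real.log Z) / Z * Z = ρ * (Real.log ρ - Real.log Z) :=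
    div_mul_cancel₀ _ hZpos.ne'
  have e2 : ρ * κ / Z * (c * Z) = κ * σ := by
    rw [← hρc]; field_simp [hZpos.ne']
  rw [e1, e2]
  rw [hσκ]
  ring
end

section
/- For every κ ≥ 0 and every Ω ∈ 𝕊, there exists a constant Λ > 0 such that the weighted Poincaré inequality holds: for every continuously differentiable function g : ℝⁿ → ℝ, ∫_𝕊 ‖∇g(ω) − (∇g(ω)·ω)ω‖² M_{κΩ}(ω) dω ≥ Λ [ ∫_𝕊 g(ω)² M_{κΩ}(ω) dω − ( ∫_𝕊 g(ω) M_{κΩ}(ω) dω )² ], where ∇g(ω) − (∇g(ω)·ω)ω is the tangential gradient on 𝕊 of the restriction of g. -/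
open MeasureTheory Metric Real

/-- Euclidean space -/
abbrev EE (n : ℕ) := EuclideanSpace ℝ (Fin n)

instance unifSphere_isProb (n : ℕ) [NeZero n] : IsProbabilityMeasure (unifSphere n) := by
  constructor
  have h0 : (volume : Measure (EE n)).toSphere Set.univ ≠ 0 := by
    rw [Ne, Measure.measure_univ_eq_zero]
    exact Measure.toSphere_ne_zero _
  have h1 : (volume : Measure (EE n)).toSphere Set.univ ≠ ⊤ := measure_ne_top _ _
  simp only [unifSphere, Measure.smul_apply, smul_eq_mul]
  exact ENNReal.inv_mul_cancel h0 h1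

/-- the action of a linear isometry on the sphere -/
noncomputable def sphAct {n : ℕ} (A : (EE n) ≃ₗᵢ[ℝ] (EE n)) (x : sphere (0 : EE n) 1) :
    sphere (0 : EE n) 1 :=
  ⟨A x, by have := x.2; simp at this ⊢⟩

open scoped Pointwise in
lemma sphAct_mp {n : ℕ} (A : (EE n) ≃ₗᵢ[ℝ] (EE n)) :
    MeasurePreserving (sphAct A) (unifSphere n) (unifSphere n) := by
  have hm : Measurable (sphAct A) :=
    (Continuous.subtype_mk (A.continuous.comp continuous_subtype_val) _).measurable
  refine MeasurePreserving.smul_measure ⟨hm, ?_⟩ _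
  ext s hs
  rw [Measure.map_apply hm hs, Measure.toSphere_apply' _ hs, Measure.toSphere_apply' _ (hm hs)]
  congr 1
  have : A ⁻¹' (Set.Ioo (0:ℝ) 1 • ((↑) '' s : Set (EE n))) =
      Set.Ioo (0:ℝ) 1 • ((↑) '' (sphAct A ⁻¹' s) : Set (EE n)) := by
    ext x
    simp only [Set.mem_preimage, Set.mem_smul, Set.mem_image]
    constructor
    · rintro ⟨t, ht, y, ⟨z, hz, rfl⟩, h⟩
      refine ⟨t, ht, A.symm z, ⟨sphAct A.symm z, ?_, rfl⟩, ?_⟩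
      · convert hz
        ext1
        simp [sphAct]
      · rw [← map_smul, h]; simp
    · rintro ⟨t, ht, y, ⟨z, hz, rfl⟩, rfl⟩
      exact ⟨t, ht, A z, ⟨_, hz, rfl⟩, by simp⟩
  rw [← this]
  exact (A.measurePreserving.measure_preimage_emb A.toHomeomorph.measurableEmbedding _)

lemma integral_sphAct {n : ℕ} (A : (EE n) ≃ₗᵢ[ℝ] (EE n)) (F : (EE n) → ℝ) (hF : Continuous F) :
    ∫ ω, F (A (ω : EE n)) ∂unifSphere n = ∫ ω, F (ω : EE n) ∂unifSphere n := by
  conv_rhs => rw [← (sphAct_mp A).map_eq]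
  rw [integral_map (sphAct_mp A).measurable.aemeasurable
    (show Continuous fun ω : sphere (0 : EE n) 1 => F ω from
      hF.comp continuous_subtype_val).aestronglyMeasurable]
  rfl

/-- the orthogonal group -/
abbrev OG (n : ℕ) : Type := ↥(unitary ((EE n) →L[ℝ] (EE n)))

instance OG_cs (n : ℕ) : ContinuousStar ((EE n) →L[ℝ] (EE n)) :=
  ⟨(ContinuousLinearMap.adjoint (𝕜 := ℝ) (E := EE n) (F := EE n)).continuous⟩
instance OG_tg (n : ℕ) : IsTopologicalGroup (OG n) := inferInstance
instance OG_sc (n : ℕ) : SecondCountableTopology (OG n) := by infer_instance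

instance OG_compact (n : ℕ) : CompactSpace (OG n) := by
  refine isCompact_iff_compactSpace.1 ?_
  refine Metric.isCompact_of_isClosed_isBounded isClosed_unitary ?_
  refine (Metric.isBounded_closedBall (x := (0 : (EE n) →L[ℝ] (EE n))) (r := 1)).subset ?_
  intro A hA
  rw [mem_closedBall_zero_iff]
  refine ContinuousLinearMap.opNorm_le_bound _ zero_le_one fun x => ?_
  have := (Unitary.linearIsometryEquiv ⟨A, hA⟩).norm_map x
  rw [one_mul]
  exact this.le

noncomputable instance OG_ms (n : ℕ) : MeasurableSpace (OG n) := borel _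
instance OG_bs (n : ℕ) : BorelSpace (OG n) := ⟨rfl⟩

/-- normalised Haar measure -/
noncomputable def OGh (n : ℕ) : Measure (OG n) := Measure.haarMeasure ⊤

instance (n : ℕ) : IsProbabilityMeasure (OGh n) := ⟨by
  have := Measure.haarMeasure_self (K₀ := (⊤ : TopologicalSpace.PositiveCompacts (OG n)))
  simpa [OGh] using this⟩
instance (n : ℕ) : (OGh n).IsMulLeftInvariant := by unfold OGh; infer_instance

lemma cont_int {X : Type*} [TopologicalSpace X] [CompactSpace X] [MeasurableSpace X]
    [OpensMeasurableSpace X] [SecondCountableTopology X] (μ : Measure X) [IsFiniteMeasure μ] (f : X → ℝ) (hf : Continuous f) :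
    Integrable f μ := by
  exact hf.integrable_of_hasCompactSupport (HasCompactSupport.of_compactSpace f)

lemma trans_OG {n : ℕ} (p q : EE n) (h : ‖p‖ = ‖q‖) : ∃ A : OG n, A.1 p = q := by
  refine ⟨Unitary.linearIsometryEquiv.symm (Submodule.reflection (ℝ ∙ (p - q))ᗮ), ?_⟩
  exact Submodule.reflection_sub h

/-- the inverse action -/
noncomputable def ac {n : ℕ} (R : OG n) (x : EE n) : EE n := (R⁻¹).1 x

lemma cont_act {n : ℕ} {X : Type*} [TopologicalSpace X] (f : X → OG n) (hf : Continuous f)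
    (x : X → EE n) (hx : Continuous x) : Continuous fun z => ac (f z) (x z) := by
  have h1 : Continuous fun z => (f z)⁻¹ := hf.inv
  have h2 : Continuous fun z => ((f z)⁻¹).1 := continuous_subtype_val.comp h1
  exact h2.clm_apply hx

lemma inv_app {n : ℕ} (R : OG n) (x : EE n) : ac R x = Unitary.linearIsometryEquiv R⁻¹ x := rfl


lemma haar_avg {n : ℕ} [NeZero n] (F : (EE n) → ℝ) (hF : Continuous F) (p : EE n) (hp : ‖p‖ = 1) :
    ∫ R : OG n, F (ac R p) ∂OGh n = ∫ ω, F (ω : EE n) ∂unifSphere n := by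
  have h1 : ∀ q : sphere (0 : EE n) 1, ∫ R : OG n, F (ac R q) ∂OGh n =
      ∫ R : OG n, F (ac R p) ∂OGh n := by
    intro q
    obtain ⟨A, hA⟩ := trans_OG p (q : EE n) (by rw [hp]; simp)
    rw [← integral_mul_left_eq_self _ A]
    refine integral_congr_ae (Filter.Eventually.of_forall fun R => ?_)
    have hA' : ac A (q : EE n) = p := by
      rw [← hA, inv_app]
      simp only [map_inv]
      exact (Unitary.linearIsometryEquiv A).symm_apply_apply p
    have e : ac (A * R) (q : EE n) = ac R (ac A (q : EE n)) := by
      unfold ac; rw [mul_inv_rev]; rfl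
    simp only [e, hA']
  have h2 : ∫ q : sphere (0 : EE n) 1, (∫ R : OG n, F (ac R q) ∂OGh n) ∂unifSphere n =
      ∫ R : OG n, F (ac R p) ∂OGh n := by
    simp [h1]
  rw [← h2, integral_integral_swap]
  · have : ∀ R : OG n, ∫ q : sphere (0 : EE n) 1, F (ac R q) ∂unifSphere n =
      ∫ ω, F (ω : EE n) ∂unifSphere n := fun R =>
        integral_sphAct (Unitary.linearIsometryEquiv R⁻¹) F hF
    simp [this]
  · apply cont_int
    exact hF.comp (cont_act _ continuous_snd _ (continuous_subtype_val.comp continuous_fst))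

/-- squared norm of the tangential gradient -/
noncomputable def tg {n : ℕ} (g : EE n → ℝ) (x : EE n) : ℝ :=
  ‖gradient g x - (@inner ℝ _ _ (gradient g x) x) • x‖ ^ 2

lemma grad_cont {n : ℕ} (g : EE n → ℝ) (hg : ContDiff ℝ 1 g) : Continuous (gradient g) := by
  have : Continuous (fderiv ℝ g) := hg.continuous_fderiv (by norm_num)
  exact (InnerProductSpace.toDual ℝ (EE n)).symm.continuous.comp this

lemma tg_cont {n : ℕ} (g : EE n → ℝ) (hg : ContDiff ℝ 1 g) : Continuous (tg g) := by
  have := grad_cont g hg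
  unfold tg
  fun_prop

lemma cs_interval (f h : ℝ → ℝ) (hf : Continuous f) (hh : Continuous h) (hfh : ∀ t, f t ^ 2 ≤ h t)
    (θ : ℝ) (hθ : 0 ≤ θ) : (∫ t in (0:ℝ)..θ, f t) ^ 2 ≤ θ * ∫ t in (0:ℝ)..θ, h t := by
  set m := ∫ t in (0:ℝ)..θ, f t with hm
  have h1 : ∫ t in (0:ℝ)..θ, f t ^ 2 ≤ ∫ t in (0:ℝ)..θ, h t :=
    intervalIntegral.integral_mono hθ ((hf.pow 2).intervalIntegrable _ _)
      (hh.intervalIntegrable _ _) hfh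
  have h2 : 0 ≤ ∫ t in (0:ℝ)..θ, (θ * f t - m) ^ 2 :=
    intervalIntegral.integral_nonneg hθ fun t _ => sq_nonneg _
  have h3 : ∫ t in (0:ℝ)..θ, (θ * f t - m) ^ 2 =
      θ ^ 2 * (∫ t in (0:ℝ)..θ, f t ^ 2) - 2 * θ * m * m + θ * m ^ 2 := by
    have e : ∀ t, (θ * f t - m) ^ 2 = θ ^ 2 * f t ^ 2 - 2 * θ * m * f t + m ^ 2 := fun t => by ring
    simp_rw [e]
    have i1 : IntervalIntegrable (fun t => θ ^ 2 * f t ^ 2) volume 0 θ :=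
      (continuous_const.mul (hf.pow 2)).intervalIntegrable _ _
    have i2 : IntervalIntegrable (fun t => 2 * θ * m * f t) volume 0 θ :=
      (continuous_const.mul hf).intervalIntegrable _ _
    rw [intervalIntegral.integral_add (i1.sub i2) (by simp), intervalIntegral.integral_sub i1 i2,
      intervalIntegral.integral_const_mul, intervalIntegral.integral_const_mul, ← hm]
    simp
  rcases hθ.eq_or_lt with h0 | h0
  · have : m = 0 := by rw [hm, ← h0]; simp
    rw [this, ← h0]; simp
  · have h4 : 0 ≤ θ * (θ * (∫ t in (0:ℝ)..θ, f t ^ 2) - m ^ 2) := by nlinarith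
    have h5 := nonneg_of_mul_nonneg_right h4 h0
    nlinarith [mul_le_mul_of_nonneg_left h1 hθ]

lemma path_bound {n : ℕ} (g : EE n → ℝ) (hg : ContDiff ℝ 1 g) (a b : EE n)
    (ha : ‖a‖ = 1) (hb : ‖b‖ = 1) (hab : @inner ℝ _ _ a b = 0) (θ : ℝ) (hθ : 0 ≤ θ) :
    (g (Real.cos θ • a + Real.sin θ • b) - g a) ^ 2 ≤
      θ * ∫ t in (0:ℝ)..θ, tg g (Real.cos t • a + Real.sin t • b) := by
  set γ : ℝ → EE n := fun t => Real.cos t • a + Real.sin t • b with hγ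
  set γ' : ℝ → EE n := fun t => (-Real.sin t) • a + Real.cos t • b with hγ'
  have hd : ∀ t, HasDerivAt γ (γ' t) t := fun t =>
    ((Real.hasDerivAt_cos t).smul_const a).add ((Real.hasDerivAt_sin t).smul_const b)
  have hγc : Continuous γ := by fun_prop
  have hγc' : Continuous γ' := by fun_prop
  have hgc := grad_cont g hg
  have hd2 : ∀ t, HasDerivAt (fun t => g (γ t)) (@inner ℝ _ _ (gradient g (γ t)) (γ' t)) t := by
    intro t
    have h1 : HasGradientAt g (gradient g (γ t)) (γ t) :=
      ((hg.differentiable (by norm_num)) (γ t)).hasGradientAt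
    have := h1.hasFDerivAt.comp_hasDerivAt t (hd t)
    exact this
  have hc : Continuous fun t => @inner ℝ _ _ (gradient g (γ t)) (γ' t) :=
    (hgc.comp hγc).inner hγc'
  have ftc := intervalIntegral.integral_eq_sub_of_hasDerivAt (a := 0) (b := θ)
    (fun t _ => hd2 t) (hc.intervalIntegrable _ _)
  have h0 : γ 0 = a := by simp [hγ]
  rw [h0] at ftc
  change (g (γ θ) - g a) ^ 2 ≤ θ * ∫ t in (0:ℝ)..θ, tg g (γ t)
  rw [← ftc]
  refine cs_interval _ _ hc ((tg_cont g hg).comp hγc) (fun t => ?_) θ hθ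
  have hba : @inner ℝ _ _ b a = 0 := by rw [real_inner_comm]; exact hab
  have haa : @inner ℝ _ _ a a = 1 := by rw [real_inner_self_eq_norm_sq, ha]; norm_num
  have hbb : @inner ℝ _ _ b b = 1 := by rw [real_inner_self_eq_norm_sq, hb]; norm_num
  have o : @inner ℝ _ _ (γ t) (γ' t) = 0 := by
    simp only [hγ, hγ', inner_add_left, inner_add_right, real_inner_smul_left,
      real_inner_smul_right, haa, hbb, hab, hba]
    ring
  have u : ‖γ' t‖ = 1 := by
    have : ‖γ' t‖ ^ 2 = 1 := by
      rw [← real_inner_self_eq_norm_sq]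
      simp only [hγ', inner_add_left, inner_add_right, real_inner_smul_left,
        real_inner_smul_right, haa, hbb, hab, hba]
      nlinarith [Real.sin_sq_add_cos_sq t]
    nlinarith [norm_nonneg (γ' t)]
  have e : @inner ℝ _ _ (gradient g (γ t)) (γ' t) = @inner ℝ _ _
      (gradient g (γ t) - (@inner ℝ _ _ (gradient g (γ t)) (γ t)) • γ t) (γ' t) := by
    rw [inner_sub_left, real_inner_smul_left, o]; ring
  rw [e, ← sq_abs]
  have := abs_real_inner_le_norm
    (gradient g (γ t) - (@inner ℝ _ _ (gradient g (γ t)) (γ t)) • γ t) (γ' t)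
  rw [u, mul_one] at this
  exact pow_le_pow_left₀ (abs_nonneg _) this 2

lemma exists_path {n : ℕ} (hn : 2 ≤ n) (p q : EE n) (hp : ‖p‖ = 1) (hq : ‖q‖ = 1) :
    ∃ v : EE n, ‖v‖ = 1 ∧ @inner ℝ _ _ p v = 0 ∧ ∃ θ : ℝ, 0 ≤ θ ∧ θ ≤ π ∧
      q = Real.cos θ • p + Real.sin θ • v := by
  set c : ℝ := @inner ℝ _ _ p q with hc
  have hpp : @inner ℝ _ _ p p = 1 := by rw [real_inner_self_eq_norm_sq, hp]; norm_num
  have hqq : @inner ℝ _ _ q q = 1 := by rw [real_inner_self_eq_norm_sq, hq]; norm_num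
  have habs : |c| ≤ 1 := by
    have := abs_real_inner_le_norm p q
    rwa [hp, hq, mul_one] at this
  have hc1 := abs_le.1 habs
  set w := q - c • p with hw
  have hpw : @inner ℝ _ _ p w = 0 := by
    rw [hw, inner_sub_right, real_inner_smul_right, hpp, ← hc]; ring
  have hww : ‖w‖ ^ 2 = 1 - c ^ 2 := by
    rw [← real_inner_self_eq_norm_sq, hw, inner_sub_left, inner_sub_right, inner_sub_right]
    simp only [real_inner_smul_left, real_inner_smul_right, hpp, hqq, ← hc,
      real_inner_comm p q]
    ring
  have hsin : Real.sin (Real.arccos c) = ‖w‖ := by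
    rw [Real.sin_arccos, ← hww, Real.sqrt_sq (norm_nonneg _)]
  by_cases hw0 : w = 0
  · obtain ⟨v, hv, hv0⟩ : ∃ v ∈ (ℝ ∙ p)ᗮ, v ≠ 0 := by
      apply Submodule.exists_mem_ne_zero_of_ne_bot
      intro hbot
      have h1 := Submodule.finrank_add_finrank_orthogonal (𝕜 := ℝ) (ℝ ∙ p)
      have h2 : Module.finrank ℝ (ℝ ∙ p) ≤ 1 := by
        simpa using finrank_span_le_card (R := ℝ) ({p} : Set (EE n))
      rw [hbot] at h1
      simp at h1
      omega
    have hpv : @inner ℝ _ _ p v = 0 := Submodule.mem_orthogonal_singleton_iff_inner_right.1 hv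
    refine ⟨‖v‖⁻¹ • v, ?_, ?_, Real.arccos c, Real.arccos_nonneg _, Real.arccos_le_pi _, ?_⟩
    · rw [norm_smul, norm_inv, norm_norm, inv_mul_cancel₀ (norm_ne_zero_iff.2 hv0)]
    · rw [real_inner_smul_right, hpv, mul_zero]
    · rw [hsin, Real.cos_arccos hc1.1 hc1.2, hw0, norm_zero, zero_smul, add_zero]
      exact sub_eq_zero.1 hw0
  · refine ⟨‖w‖⁻¹ • w, ?_, ?_, Real.arccos c, Real.arccos_nonneg _, Real.arccos_le_pi _, ?_⟩
    · rw [norm_smul, norm_inv, norm_norm, inv_mul_cancel₀ (norm_ne_zero_iff.2 hw0)]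
    · rw [real_inner_smul_right, hpw, mul_zero]
    · rw [hsin, Real.cos_arccos hc1.1 hc1.2, smul_smul,
        mul_inv_cancel₀ (norm_ne_zero_iff.2 hw0), one_smul, hw]
      abel

lemma cont_int_Ioc {X : Type*} [TopologicalSpace X] [CompactSpace X] [MeasurableSpace X]
    [OpensMeasurableSpace X] [SecondCountableTopology X] (μ : Measure X) [IsFiniteMeasure μ]
    (f : ℝ × X → ℝ) (hf : Continuous f) (a b : ℝ) :
    Integrable f ((volume.restrict (Set.uIoc a b)).prod μ) := by
  obtain ⟨C, hC⟩ := (isCompact_uIcc.prod isCompact_univ : IsCompact (Set.uIcc a b ×ˢ (Set.univ : Set X))).exists_bound_of_continuousOn hf.continuousOn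
  have : IsFiniteMeasure (volume.restrict (Set.uIoc a b)) := by
    unfold Set.uIoc; infer_instance
  refine Integrable.of_bound hf.aestronglyMeasurable C ?_
  have h1 : ∀ᵐ t ∂(volume.restrict (Set.uIoc a b)), t ∈ Set.uIoc a b :=
    ae_restrict_mem measurableSet_uIoc
  have h2 : ∀ᵐ z ∂((volume.restrict (Set.uIoc a b)).prod μ), z.1 ∈ Set.uIoc a b :=
    Measure.quasiMeasurePreserving_fst.ae h1
  filter_upwards [h2] with z hz
  exact hC z ⟨Set.uIoc_subset_uIcc hz, Set.mem_univ _⟩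

lemma pair_bound {n : ℕ} [NeZero n] (hn : 2 ≤ n) (g : EE n → ℝ) (hg : ContDiff ℝ 1 g) (p q : EE n)
    (hp : ‖p‖ = 1) (hq : ‖q‖ = 1) :
    ∫ R : OG n, (g (ac R q) - g (ac R p)) ^ 2 ∂OGh n ≤
      π ^ 2 * ∫ ω, tg g (ω : EE n) ∂unifSphere n := by
  obtain ⟨v, hv, hpv, θ, h0, hπ, hqe⟩ := exists_path hn p q hp hq
  have hE : 0 ≤ ∫ ω, tg g (ω : EE n) ∂unifSphere n :=
    integral_nonneg fun ω => by unfold tg; positivity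
  have hun : ∀ t : ℝ, ‖Real.cos t • p + Real.sin t • v‖ = 1 := by
    intro t
    have hpp : @inner ℝ _ _ p p = 1 := by rw [real_inner_self_eq_norm_sq, hp]; norm_num
    have hvv : @inner ℝ _ _ v v = 1 := by rw [real_inner_self_eq_norm_sq, hv]; norm_num
    have hvp : @inner ℝ _ _ v p = 0 := by rw [real_inner_comm]; exact hpv
    have : ‖Real.cos t • p + Real.sin t • v‖ ^ 2 = 1 := by
      rw [← real_inner_self_eq_norm_sq]
      simp only [inner_add_left, inner_add_right, real_inner_smul_left,
        real_inner_smul_right, hpp, hvv, hpv, hvp]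
      nlinarith [Real.sin_sq_add_cos_sq t]
    nlinarith [norm_nonneg (Real.cos t • p + Real.sin t • v)]
  have hca : ∀ x : EE n, Continuous fun R : OG n => ac R x := fun x =>
    cont_act _ continuous_id _ continuous_const
  have hcz : Continuous fun z : ℝ × OG n =>
      ac z.2 (Real.cos z.1 • p + Real.sin z.1 • v) := by
    have hc0 : Continuous fun t : ℝ => Real.cos t • p + Real.sin t • v := by fun_prop
    exact cont_act _ continuous_snd _ (hc0.comp continuous_fst)
  have hct : Continuous fun z : ℝ × OG n =>
      tg g (ac z.2 (Real.cos z.1 • p + Real.sin z.1 • v)) := (tg_cont g hg).comp hcz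
  have hi := cont_int_Ioc (OGh n) _ hct 0 θ
  have hpt : ∀ R : OG n, (g (ac R q) - g (ac R p)) ^ 2 ≤
      θ * ∫ t in (0:ℝ)..θ, tg g (ac R (Real.cos t • p + Real.sin t • v)) := by
    intro R
    have := path_bound g hg (ac R p) (ac R v)
      (by rw [inv_app, LinearIsometryEquiv.norm_map, hp])
      (by rw [inv_app, LinearIsometryEquiv.norm_map, hv])
      (by rw [inv_app, inv_app, LinearIsometryEquiv.inner_map_map, hpv]) θ h0
    rw [hqe]
    simpa only [inv_app, map_add, map_smul] using this
  have hsw := intervalIntegral_integral_swap (μ := OGh n) (a := 0) (b := θ)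
    (f := fun t R => tg g (ac R (Real.cos t • p + Real.sin t • v))) hi
  calc ∫ R : OG n, (g (ac R q) - g (ac R p)) ^ 2 ∂OGh n
      ≤ ∫ R : OG n, (θ * ∫ t in (0:ℝ)..θ, tg g (ac R (Real.cos t • p + Real.sin t • v))) ∂OGh n := by
        refine integral_mono ?_ ?_ hpt
        · apply cont_int
          have c1 := hg.continuous.comp (hca q)
          have c2 := hg.continuous.comp (hca p)
          exact (c1.sub c2).pow 2
        · apply Integrable.const_mul
          have := hi.integral_prod_right
          rw [Set.uIoc_of_le h0] at this
          simp_rw [intervalIntegral.integral_of_le h0]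
          exact this
    _ = θ * (θ * ∫ ω, tg g (ω : EE n) ∂unifSphere n) := by
        rw [integral_const_mul, ← hsw]
        congr 1
        have : ∀ t : ℝ, ∫ R : OG n, tg g (ac R (Real.cos t • p + Real.sin t • v)) ∂OGh n =
          ∫ ω, tg g (ω : EE n) ∂unifSphere n := fun t =>
            haar_avg (tg g) (tg_cont g hg) _ (hun t)
        simp_rw [this]
        simp
    _ ≤ π ^ 2 * ∫ ω, tg g (ω : EE n) ∂unifSphere n := by
        rw [← mul_assoc]
        apply mul_le_mul_of_nonneg_right _ hE
        nlinarith [Real.pi_pos]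

lemma unif_poincare {n : ℕ} [NeZero n] (hn : 2 ≤ n) (g : EE n → ℝ) (hg : ContDiff ℝ 1 g) :
    ∫ x, (g (x : EE n) - ∫ y, g (y : EE n) ∂unifSphere n) ^ 2 ∂unifSphere n ≤
      π ^ 2 * ∫ ω, tg g (ω : EE n) ∂unifSphere n := by
  set σ := unifSphere n with hσ
  set E := ∫ ω, tg g (ω : EE n) ∂σ with hE
  set m := ∫ y, g (y : EE n) ∂σ with hm
  have hgc := hg.continuous
  have gs : Continuous fun x : sphere (0 : EE n) 1 => g (x : EE n) :=
    hgc.comp continuous_subtype_val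
  set V := ∫ x, (g (x : EE n) - m) ^ 2 ∂σ with hV
  have hV0 : 0 ≤ V := integral_nonneg fun _ => sq_nonneg _
  -- for fixed `p`, the average of `(g y - g p)^2` over `y`
  have h1 : ∀ c : ℝ, ∫ y, (g (y : EE n) - c) ^ 2 ∂σ = V + (m - c) ^ 2 := by
    intro c
    have e : ∀ y : sphere (0 : EE n) 1, (g (y : EE n) - c) ^ 2 =
      (g (y : EE n) - m) ^ 2 + 2 * (m - c) * (g (y : EE n)) + (c ^ 2 - m ^ 2) := fun y => by ring
    simp_rw [e]
    rw [integral_add (cont_int _ _ (by fun_prop)) (by simp),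
      integral_add (cont_int _ _ (by fun_prop)) (cont_int _ _ (by fun_prop)), integral_const_mul]
    simp only [integral_const, probReal_univ, smul_eq_mul, one_mul]
    rw [← hm, ← hV]
    ring
  have h2 : ∫ x, (∫ y, (g (y : EE n) - g (x : EE n)) ^ 2 ∂σ) ∂σ = 2 * V := by
    simp_rw [h1]
    rw [integral_add (by simp) (cont_int _ _ (by fun_prop))]
    simp only [integral_const, probReal_univ, smul_eq_mul, one_mul]
    have : ∫ x, (m - g (x : EE n)) ^ 2 ∂σ = V := by
      rw [hV]; congr 1; ext x; ring
    rw [this]; ring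
  have hinv : ∀ (R : OG n) (F : EE n → ℝ), Continuous F →
      ∫ ω, F (ac R (ω : EE n)) ∂σ = ∫ ω, F (ω : EE n) ∂σ := fun R F hF =>
    integral_sphAct (Unitary.linearIsometryEquiv R⁻¹) F hF
  have h3 : ∀ R : OG n, ∫ z : sphere (0 : EE n) 1 × sphere (0 : EE n) 1,
      (g (ac R (z.2 : EE n)) - g (ac R (z.1 : EE n))) ^ 2 ∂(σ.prod σ) = 2 * V := by
    intro R
    have ca : ∀ {Y : Type} [TopologicalSpace Y] (x : Y → EE n), Continuous x →
        Continuous fun y => g (ac R (x y)) := fun x hx =>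
      hgc.comp (cont_act _ continuous_const _ hx)
    rw [integral_prod]
    · have e1 : ∀ x : sphere (0 : EE n) 1,
          ∫ y, (g (ac R (y : EE n)) - g (ac R (x : EE n))) ^ 2 ∂σ =
            V + (m - g (ac R (x : EE n))) ^ 2 := by
        intro x
        rw [hinv R (fun y => (g y - g (ac R (x : EE n))) ^ 2) (by fun_prop), h1]
      simp_rw [e1]
      rw [hinv R (fun y => V + (m - g y) ^ 2) (by fun_prop), ← h2]
      simp_rw [h1]
    · apply cont_int
      exact ((ca _ (continuous_subtype_val.comp continuous_snd)).sub
        (ca _ (continuous_subtype_val.comp continuous_fst))).pow 2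
  have h4 : ∫ z : sphere (0 : EE n) 1 × sphere (0 : EE n) 1, (∫ R : OG n,
      (g (ac R (z.2 : EE n)) - g (ac R (z.1 : EE n))) ^ 2 ∂OGh n) ∂(σ.prod σ) = 2 * V := by
    rw [integral_integral_swap]
    · simp [h3]
    · apply cont_int
      have c1 := hgc.comp (cont_act (X := (sphere (0 : EE n) 1 × sphere (0 : EE n) 1) × OG n) _
        continuous_snd (fun z => (z.1.2 : EE n))
        (continuous_subtype_val.comp (continuous_snd.comp continuous_fst)))
      have c2 := hgc.comp (cont_act (X := (sphere (0 : EE n) 1 × sphere (0 : EE n) 1) × OG n) _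
        continuous_snd (fun z => (z.1.1 : EE n))
        (continuous_subtype_val.comp (continuous_fst.comp continuous_fst)))
      exact (c1.sub c2).pow 2
  have h5 : 2 * V ≤ π ^ 2 * E := by
    rw [← h4]
    have : ∫ z : sphere (0 : EE n) 1 × sphere (0 : EE n) 1, π ^ 2 * E ∂(σ.prod σ) = π ^ 2 * E := by
      simp
    rw [← this]
    refine integral_mono_of_nonneg (Filter.Eventually.of_forall fun z => ?_) (integrable_const _)
      (Filter.Eventually.of_forall fun z => ?_)
    · exact integral_nonneg fun _ => sq_nonneg _
    · exact pair_bound hn g hg (z.1 : EE n) (z.2 : EE n) (norm_eq_of_mem_sphere z.1)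
        (norm_eq_of_mem_sphere z.2)
  linarith

/-- Weighted Poincaré inequality for the von Mises distribution: there is `Λ > 0` such
that for every `C¹` function `g : ℝⁿ → ℝ`, the variance of `g` with respect to
`M_{κΩ} dω` is controlled by the Dirichlet energy of the tangential gradient of `g`. -/
theorem weighted_poincare_vonMises (n : ℕ) (hn : 2 ≤ n) (κ : ℝ) (hκ : 0 ≤ κ)
    (Ω : sphere (0 : EuclideanSpace ℝ (Fin n)) 1) :
    ∃ Λ : ℝ, 0 < Λ ∧ ∀ g : EuclideanSpace ℝ (Fin n) → ℝ, ContDiff ℝ 1 g →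
      ∫ ω, ‖gradient g (ω : EuclideanSpace ℝ (Fin n)) -
            (@inner ℝ _ _ (gradient g (ω : EuclideanSpace ℝ (Fin n)))
              (ω : EuclideanSpace ℝ (Fin n))) • (ω : EuclideanSpace ℝ (Fin n))‖ ^ 2 *
          vonMises n κ Ω ω ∂ unifSphere n
      ≥ Λ * ((∫ ω, g (ω : EuclideanSpace ℝ (Fin n)) ^ 2 * vonMises n κ Ω ω ∂ unifSphere n)
          - (∫ ω, g (ω : EuclideanSpace ℝ (Fin n)) * vonMises n κ Ω ω ∂ unifSphere n) ^ 2) := by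
  have : NeZero n := ⟨by omega⟩
  have hw : Continuous fun ω : sphere (0 : EE n) 1 =>
      Real.exp (κ * @inner ℝ _ _ (ω : EE n) (Ω : EE n)) := by fun_prop
  set Z := ∫ υ, Real.exp (κ * @inner ℝ _ _ (υ : EE n) (Ω : EE n)) ∂ unifSphere n with hZ
  have hin : ∀ ω : sphere (0 : EE n) 1, |@inner ℝ _ _ (ω : EE n) (Ω : EE n)| ≤ 1 := fun ω => by
    simpa using abs_real_inner_le_norm (ω : EE n) (Ω : EE n)
  have hlo : ∀ ω : sphere (0 : EE n) 1,
      Real.exp (-κ) ≤ Real.exp (κ * @inner ℝ _ _ (ω : EE n) (Ω : EE n)) := fun ω => by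
    apply Real.exp_le_exp.2
    nlinarith [(abs_le.1 (hin ω)).1]
  have hhi : ∀ ω : sphere (0 : EE n) 1,
      Real.exp (κ * @inner ℝ _ _ (ω : EE n) (Ω : EE n)) ≤ Real.exp κ := fun ω => by
    apply Real.exp_le_exp.2
    nlinarith [(abs_le.1 (hin ω)).2]
  have hZ0 : 0 < Z := by
    have h1 : ∫ _υ : sphere (0 : EE n) 1, Real.exp (-κ) ∂ unifSphere n ≤ Z :=
      integral_mono (by simp) (cont_int _ _ hw) hlo
    simp at h1
    exact (Real.exp_pos _).trans_le h1
  set w : sphere (0 : EE n) 1 → ℝ := fun ω => vonMises n κ Ω ω with hwdef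
  have hwe : ∀ ω, w ω = Real.exp (κ * @inner ℝ _ _ (ω : EE n) (Ω : EE n)) / Z := fun ω => rfl
  have hwc : Continuous w := hw.div_const Z
  have hw1 : ∫ ω, w ω ∂ unifSphere n = 1 := by
    simp_rw [hwe]
    rw [integral_div, ← hZ, div_self hZ0.ne']
  have hwlo : ∀ ω, Real.exp (-κ) / Z ≤ w ω := fun ω => by
    rw [hwe]; exact div_le_div_of_nonneg_right (hlo ω) hZ0.le
  have hwhi : ∀ ω, w ω ≤ Real.exp κ / Z := fun ω => by
    rw [hwe]; exact div_le_div_of_nonneg_right (hhi ω) hZ0.le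
  have hek := Real.exp_pos κ
  have hek' := Real.exp_pos (-κ)
  refine ⟨Real.exp (-κ) / (Real.exp κ * π ^ 2), by positivity, fun g hg => ?_⟩
  change (∫ ω, tg g (ω : EE n) * w ω ∂ unifSphere n) ≥ _ * ((∫ ω, g (ω : EE n) ^ 2 * w ω ∂ unifSphere n)
          - (∫ ω, g (ω : EE n) * w ω ∂ unifSphere n) ^ 2)
  have gs : Continuous fun x : sphere (0 : EE n) 1 => g (x : EE n) :=
    hg.continuous.comp continuous_subtype_val
  have ts : Continuous fun x : sphere (0 : EE n) 1 => tg g (x : EE n) :=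
    (tg_cont g hg).comp continuous_subtype_val
  have hP := unif_poincare hn g hg
  set m := ∫ y, g (y : EE n) ∂unifSphere n with hm
  set V := ∫ x, (g (x : EE n) - m) ^ 2 ∂unifSphere n with hV
  set E := ∫ ω, tg g (ω : EE n) ∂unifSphere n with hE
  set A := ∫ ω, g (ω : EE n) ^ 2 * w ω ∂ unifSphere n with hA
  set B := ∫ ω, g (ω : EE n) * w ω ∂ unifSphere n with hB
  have h1 : ∫ x, (g (x : EE n) - m) ^ 2 * w x ∂unifSphere n = A - 2 * m * B + m ^ 2 := by
    have e : ∀ x : sphere (0 : EE n) 1, (g (x : EE n) - m) ^ 2 * w x =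
      g (x : EE n) ^ 2 * w x - 2 * m * (g (x : EE n) * w x) + m ^ 2 * w x := fun x => by ring
    simp_rw [e]
    rw [integral_add (cont_int _ _ (by fun_prop)) (cont_int _ _ (by fun_prop)),
      integral_sub (cont_int _ _ (by fun_prop)) (cont_int _ _ (by fun_prop)),
      integral_const_mul, integral_const_mul, hw1]
    rw [← hA, ← hB]
    ring
  have h2 : ∫ x, (g (x : EE n) - m) ^ 2 * w x ∂unifSphere n ≤ V * (Real.exp κ / Z) := by
    rw [hV, ← integral_mul_const]
    refine integral_mono (cont_int _ _ (by fun_prop)) (cont_int _ _ (by fun_prop)) fun x => ?_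
    exact mul_le_mul_of_nonneg_left (hwhi x) (sq_nonneg _)
  have h3 : E * (Real.exp (-κ) / Z) ≤ ∫ ω, tg g (ω : EE n) * w ω ∂ unifSphere n := by
    rw [hE, ← integral_mul_const]
    refine integral_mono (cont_int _ _ (by fun_prop)) (cont_int _ _ (by fun_prop)) fun x => ?_
    exact mul_le_mul_of_nonneg_left (hwlo x) (by unfold tg; positivity)
  refine le_trans ?_ h3
  have h4 : A - B ^ 2 ≤ π ^ 2 * E * (Real.exp κ / Z) := by
    have := mul_le_mul_of_nonneg_right hP (div_pos hek hZ0).le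
    nlinarith [sq_nonneg (m - B)]
  calc Real.exp (-κ) / (Real.exp κ * π ^ 2) * (A - B ^ 2)
      ≤ Real.exp (-κ) / (Real.exp κ * π ^ 2) * (π ^ 2 * E * (Real.exp κ / Z)) :=
        mul_le_mul_of_nonneg_left h4 (by positivity)
    _ = E * (Real.exp (-κ) / Z) := by
        have := Real.pi_pos
        field_simp
end
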